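/- For every ground program P over a type α of atoms and every i ≥ 0, the unknown set of the alternating fixpoint procedure satisfies the optimized recurrence U_i = K_i ∪ lfp(S ↦ T_{P,K_i}(K_i ∪ S)); that is, U_i is obtained from K_i by adjoining the least fixed point of the operator that applies T_{P,K_i} to the union of K_i with its argument. -/

import Mathlib

/-- A ground rule: head atom, finite set of positive subgoals, finite set of negative subgoals. -/
structure GroundRule (α : Type*) where
  head : α
  pos : Finset α
  neg : Finset α

/-- The extended immediate consequence operator `T_{P,J}(I)`. -/
def Tstep {α : Type*} (P : Set (GroundRule α)) (J I : Set α) : Set α :=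
  {a | ∃ r ∈ P, r.head = a ∧ ↑r.pos ⊆ I ∧ (↑r.neg ∩ J : Set α) = ∅}

lemma Tstep_mono {α : Type*} (P : Set (GroundRule α)) (J : Set α) : Monotone (Tstep P J) := by
  rintro I I' h a ⟨r, hr, hh, hpos, hneg⟩
  exact ⟨r, hr, hh, hpos.trans h, hneg⟩

/-- `T_{P,J}` bundled as a monotone map on the complete lattice of subsets of `α`. -/
def TstepHom {α : Type*} (P : Set (GroundRule α)) (J : Set α) : Set α →o Set α :=
  ⟨Tstep P J, Tstep_mono P J⟩

/-- The least fixed point of `I ↦ T_{P,J}(I)` (Knaster–Tarski). -/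
def Tlfp {α : Type*} (P : Set (GroundRule α)) (J : Set α) : Set α :=
  OrderHom.lfp (TstepHom P J)

/-- The definite part `P⁺` of `P`: the rules with no negative subgoals. -/
def definitePart {α : Type*} (P : Set (GroundRule α)) : Set (GroundRule α) :=
  {r ∈ P | r.neg = ∅}

/-- The alternating fixpoint sequence `(K_i, U_i)`:
`K₀ := lfp (T_{P⁺,∅})`, `U₀ := lfp (T_{P,K₀})`, and for `i > 0`,
`K_i := lfp (T_{P,U_{i-1}})`, `U_i := lfp (T_{P,K_i})`. -/
def AFP {α : Type*} (P : Set (GroundRule α)) : ℕ → Set α × Set α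
  | 0 => (Tlfp (definitePart P) ∅, Tlfp P (Tlfp (definitePart P) ∅))
  | i + 1 => (Tlfp P (AFP P i).2, Tlfp P (Tlfp P (AFP P i).2))

/-- The true (known) sets `K_i` of the alternating fixpoint procedure. -/
def Kseq {α : Type*} (P : Set (GroundRule α)) (i : ℕ) : Set α := (AFP P i).1

/-- The possible (unknown) sets `U_i` of the alternating fixpoint procedure. -/
def Useq {α : Type*} (P : Set (GroundRule α)) (i : ℕ) : Set α := (AFP P i).2

lemma Tstep_anti {α : Type*} (P : Set (GroundRule α)) {J J' : Set α} (h : J ⊆ J') (I : Set α) :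
    Tstep P J' I ⊆ Tstep P J I := by
  rintro a ⟨r, hr, hh, hpos, hneg⟩
  exact ⟨r, hr, hh, hpos,
    Set.subset_eq_empty (Set.inter_subset_inter_right _ h) hneg⟩

lemma Tstep_Tlfp {α : Type*} (P : Set (GroundRule α)) (J : Set α) :
    Tstep P J (Tlfp P J) = Tlfp P J :=
  (TstepHom P J).map_lfp

lemma Tlfp_subset {α : Type*} {P : Set (GroundRule α)} {J I : Set α} (h : Tstep P J I ⊆ I) :
    Tlfp P J ⊆ I :=
  OrderHom.lfp_le (TstepHom P J) h

lemma Tlfp_anti {α : Type*} (P : Set (GroundRule α)) {J J' : Set α} (h : J ⊆ J') :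
    Tlfp P J' ⊆ Tlfp P J :=
  Tlfp_subset ((Tstep_anti P h _).trans (Tstep_Tlfp P J).subset)

lemma Tlfp_definitePart_subset {α : Type*} (P : Set (GroundRule α)) (J J' : Set α) :
    Tlfp (definitePart P) J ⊆ Tlfp P J' := by
  refine Tlfp_subset (Set.Subset.trans ?_ (Tstep_Tlfp P J').subset)
  rintro a ⟨r, ⟨hr, hr0⟩, hh, hpos, -⟩
  exact ⟨r, hr, hh, hpos, by simp [hr0]⟩

lemma Useq_eq_Tlfp {α : Type*} (P : Set (GroundRule α)) (i : ℕ) :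
    Useq P i = Tlfp P (Kseq P i) := by
  cases i <;> rfl

lemma Kseq_succ {α : Type*} (P : Set (GroundRule α)) (i : ℕ) :
    Kseq P (i + 1) = Tlfp P (Useq P i) :=
  rfl

lemma Kseq_subset_Useq {α : Type*} (P : Set (GroundRule α)) (i : ℕ) :
    Kseq P i ⊆ Useq P i := by
  induction i with
  | zero => exact Tlfp_definitePart_subset P _ _
  | succ i ih =>
    rw [Useq_eq_Tlfp P (i + 1), Kseq_succ]
    refine Tlfp_anti P ?_
    conv_rhs => rw [Useq_eq_Tlfp]
    exact Tlfp_anti P ih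

/-- Optimized recurrence for the unknown sets: for all `i ≥ 0`,
`U_i = K_i ∪ lfp (S ↦ T_{P,K_i}(K_i ∪ S))`. -/
theorem Useq_opt_recurrence {α : Type*} (P : Set (GroundRule α)) (i : ℕ) :
    Useq P i = Kseq P i ∪
      OrderHom.lfp ⟨fun S => Tstep P (Kseq P i) (Kseq P i ∪ S),
        fun _ _ h => Tstep_mono P _ (Set.union_subset_union_right _ h)⟩ := by
  have hKU := Kseq_subset_Useq P i
  rw [Useq_eq_Tlfp] at hKU ⊢
  apply Set.Subset.antisymm
  · refine Tlfp_subset (Set.Subset.trans ?_ Set.subset_union_right)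
    exact (OrderHom.map_lfp (⟨fun S => Tstep P (Kseq P i) (Kseq P i ∪ S),
      fun _ _ h => Tstep_mono P _ (Set.union_subset_union_right _ h)⟩ : Set α →o Set α)).le
  · refine Set.union_subset hKU (OrderHom.lfp_le _ ?_)
    change Tstep P (Kseq P i) (Kseq P i ∪ Tlfp P (Kseq P i)) ⊆ _
    rw [Set.union_eq_self_of_subset_left hKU, Tstep_Tlfp]
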